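/- arXiv:1508.04344 — 4 statements merged into one kernel-verified Lean document; each statement's English description precedes it below -/
import Mathlib

section
/- Let λ : ℝ → ℝ be differentiable and satisfy λ'(t) = 2·λ(t)² - 1 for all t ≥ 0, with λ(0) ∈ (-1, 1/√2). Then λ(t) → -1/√2 as t → +∞. -/
/-- A solution of a scalar homogeneous linear equation `F' = a F` on `[0, ∞)` with `F 0 = 0`
vanishes on `[0, ∞)`. -/
theorem eq_zero_of_hasDerivAt_linear {F a : ℝ → ℝ} (ha : Continuous a)
    (hF : ∀ t : ℝ, 0 ≤ t → HasDerivAt F (a t * F t) t) (hF0 : F 0 = 0)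
    {T : ℝ} (hT : 0 ≤ T) : F T = 0 := by
  set A : ℝ → ℝ := fun t => ∫ s in (0 : ℝ)..t, a s with hA
  have hAd (t : ℝ) : HasDerivAt A (a t) t :=
    intervalIntegral.integral_hasDerivAt_right (ha.intervalIntegrable _ _)
      ha.stronglyMeasurable.stronglyMeasurableAtFilter ha.continuousAt
  have hG (t : ℝ) (ht : 0 ≤ t) : HasDerivAt (fun t => F t * Real.exp (-A t)) 0 t := by
    refine ((hF t ht).mul (hAd t).fun_neg.exp).congr_deriv ?_
    ring
  have hconst := constant_of_has_deriv_right_zero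
    (fun t ht => (hG t ht.1).continuousAt.continuousWithinAt)
    (fun t ht => (hG t ht.1).hasDerivWithinAt) T (Set.right_mem_Icc.2 hT)
  simpa [hF0, Real.exp_ne_zero] using hconst

/-- Closed form of the solutions of `x' = 2 (x² - c²)` with `x 0 ≠ c`, without division by the
possibly vanishing quantity `c - x`. -/
theorem add_eq_mul_exp_of_hasDerivAt_quadratic {x : ℝ → ℝ} {c : ℝ} (hx : Continuous x)
    (hode : ∀ t : ℝ, 0 ≤ t → HasDerivAt x (2 * (x t ^ 2 - c ^ 2)) t) (h0 : c - x 0 ≠ 0)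
    {t : ℝ} (ht : 0 ≤ t) :
    x t + c = (x 0 + c) / (c - x 0) * Real.exp (-(4 * c) * t) * (c - x t) := by
  set K := (x 0 + c) / (c - x 0) with hK
  have hzero : x t + c - K * Real.exp (-(4 * c) * t) * (c - x t) = 0 := by
    refine eq_zero_of_hasDerivAt_linear (a := fun s => -2 * (c - x s))
      (F := fun s => x s + c - K * Real.exp (-(4 * c) * s) * (c - x s))
      (by fun_prop) (fun s hs => ?_) ?_ ht
    · have hexp : HasDerivAt (fun s => K * Real.exp (-(4 * c) * s))
          (K * (Real.exp (-(4 * c) * s) * (-(4 * c) * 1))) s :=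
        (((hasDerivAt_id s).const_mul (-(4 * c))).exp).const_mul K
      refine (((hode s hs).add_const c).sub (hexp.mul ((hode s hs).const_sub c))).congr_deriv ?_
      ring
    · simp [hK, h0]
  linarith

/-- In the fast switching-layer subsystem `λ' = 2λ² - 1`, any solution starting in
`(-1, 1/√2)` converges to the attracting equilibrium `-1/√2`. -/
theorem fast_layer_attractor (l : ℝ → ℝ) (hdiff : Differentiable ℝ l)
    (hode : ∀ t : ℝ, 0 ≤ t → deriv l t = 2 * (l t) ^ 2 - 1)
    (h0 : l 0 ∈ Set.Ioo (-1 : ℝ) (1 / Real.sqrt 2)) :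
    Filter.Tendsto l Filter.atTop (nhds (-1 / Real.sqrt 2)) := by
  set c : ℝ := 1 / Real.sqrt 2 with hc
  have hcpos : 0 < c := by positivity
  have hcsq : c ^ 2 = 1 / 2 := by
    rw [hc, div_pow, Real.sq_sqrt zero_le_two, one_pow]
  have hder (t : ℝ) (ht : 0 ≤ t) : HasDerivAt l (2 * (l t ^ 2 - c ^ 2)) t := by
    refine (hdiff t).hasDerivAt.congr_deriv ?_
    rw [hode t ht, hcsq]
    ring
  set K := (l 0 + c) / (c - l 0) with hK
  have hexp : Filter.Tendsto (fun t => K * Real.exp (-(4 * c) * t)) Filter.atTop (nhds 0) := by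
    have h := (Real.tendsto_exp_atBot.comp
      (Filter.tendsto_id.const_mul_atTop_of_neg (by linarith : -(4 * c) < 0))).const_mul K
    simpa using h
  have hlim : Filter.Tendsto (fun t => c - 2 * c / (1 + K * Real.exp (-(4 * c) * t)))
      Filter.atTop (nhds (c - 2 * c / (1 + 0))) :=
    tendsto_const_nhds.sub (tendsto_const_nhds.div (hexp.const_add 1) (by norm_num))
  have hval : c - 2 * c / (1 + 0) = -1 / Real.sqrt 2 := by
    rw [neg_div, ← hc]
    ring
  rw [← hval]
  refine hlim.congr' ?_
  filter_upwards [Filter.eventually_ge_atTop 0] with t ht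
  have hsol := add_eq_mul_exp_of_hasDerivAt_quadratic hdiff.continuous hder
    (sub_pos.2 h0.2).ne' ht
  rw [← hK] at hsol
  have hmul : (c - l t) * (1 + K * Real.exp (-(4 * c) * t)) = 2 * c := by linarith
  have hne : 1 + K * Real.exp (-(4 * c) * t) ≠ 0 :=
    right_ne_zero_of_mul (hmul ▸ (by positivity : 2 * c ≠ 0))
  rw [← hmul, mul_div_cancel_right₀ _ hne]
  ring
end

section
/- Let a be a nonzero real number, k₀ a real number, and set α = √(1 + 1/(4a²)). Then the function y(t) = -1/(2a) + α·tanh(α·a·t + k₀) satisfies the differential equation y'(t) = a·(1 - y(t)²) - y(t) for all t ∈ ℝ. -/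
theorem Real.hasDerivAt_tanh_one_sub_sq (x : ℝ) :
    HasDerivAt Real.tanh (1 - Real.tanh x ^ 2) x := by
  have hc : Real.cosh x ≠ 0 := (Real.cosh_pos x).ne'
  have hquot := (Real.hasDerivAt_sinh x).fun_div (Real.hasDerivAt_cosh x) hc
  rw [← funext Real.tanh_eq_sinh_div_cosh] at hquot
  refine hquot.congr_deriv ?_
  rw [Real.tanh_eq_sinh_div_cosh]
  field_simp

/-- The explicit solution of the bistable-decay fast subsystem `y' = a(1-y²) - y`:
`y(t) = -1/(2a) + α·tanh(α a t + k₀)` with `α = √(1 + 1/(4a²))`. -/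
theorem bistable_decay_solution (a k₀ : ℝ) (ha : a ≠ 0)
    (α : ℝ) (hα : α = Real.sqrt (1 + 1 / (4 * a ^ 2)))
    (y : ℝ → ℝ) (hy : ∀ t : ℝ, y t = -1 / (2 * a) + α * Real.tanh (α * a * t + k₀)) :
    ∀ t : ℝ, deriv y t = a * (1 - (y t) ^ 2) - y t := by
  intro t
  have hsq : α ^ 2 = 1 + 1 / (4 * a ^ 2) := by
    rw [hα, Real.sq_sqrt (by positivity)]
  have hlin : HasDerivAt (fun s : ℝ => α * a * s + k₀) (α * a) t := by
    simpa using ((hasDerivAt_id t).const_mul (α * a)).add_const k₀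
  have hderiv : HasDerivAt y
      (α * ((1 - Real.tanh (α * a * t + k₀) ^ 2) * (α * a))) t := by
    rw [funext hy]
    exact (((Real.hasDerivAt_tanh_one_sub_sq _).comp t hlin).const_mul α).const_add _
  rw [hderiv.deriv, hy t]
  generalize Real.tanh (α * a * t + k₀) = T
  calc α * ((1 - T ^ 2) * (α * a)) = a * α ^ 2 - a * α ^ 2 * T ^ 2 := by ring
    _ = a * (1 + 1 / (4 * a ^ 2)) - a * α ^ 2 * T ^ 2 := by rw [← hsq]
    _ = a * (1 - (-1 / (2 * a) + α * T) ^ 2) - (-1 / (2 * a) + α * T) := by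
      field_simp
      ring
end

section
/- Let a be a nonzero real number and set y* = (√(1+4a²) - 1)/(2a). Then |y* - sign(a) + 1/(2a)| ≤ 1/(8a²), where sign(a) = 1 if a > 0 and sign(a) = -1 if a < 0. -/
/-- The square root `√(1 + 4b²)` exceeds its asymptote `2b` by at most `1/(4b)`. -/
theorem abs_sqrt_one_add_four_mul_sq_sub_le {b : ℝ} (hb : 0 < b) :
    |Real.sqrt (1 + 4 * b ^ 2) - 2 * b| ≤ 1 / (4 * b) := by
  have lower : 2 * b ≤ Real.sqrt (1 + 4 * b ^ 2) := Real.le_sqrt_of_sq_le (by nlinarith)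
  have upper : Real.sqrt (1 + 4 * b ^ 2) ≤ 2 * b + 1 / (4 * b) := by
    refine Real.sqrt_le_iff.mpr ⟨by positivity, ?_⟩
    have expand : (2 * b + 1 / (4 * b)) ^ 2 = 1 + 4 * b ^ 2 + (1 / (4 * b)) ^ 2 := by
      field_simp
      ring
    rw [expand]
    exact le_add_of_nonneg_right (sq_nonneg _)
  rw [abs_of_nonneg (sub_nonneg.mpr lower)]
  linarith

/-- Asymptotics of the stationary state: `|y* - sign(a) + 1/(2a)| ≤ 1/(8a²)`. -/
theorem bistable_decay_asymptotics (a : ℝ) (ha : a ≠ 0)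
    (ystar : ℝ) (hystar : ystar = (Real.sqrt (1 + 4 * a ^ 2) - 1) / (2 * a)) :
    |ystar - (if 0 < a then (1 : ℝ) else -1) + 1 / (2 * a)| ≤ 1 / (8 * a ^ 2) := by
  have sign_eq : (if 0 < a then (1 : ℝ) else -1) = |a| / a := by
    split_ifs with h
    · rw [abs_of_pos h, div_self ha]
    · rw [abs_of_nonpos (not_lt.mp h), neg_div, div_self ha]
  have rewrite_diff : ystar - |a| / a + 1 / (2 * a) =
      (Real.sqrt (1 + 4 * |a| ^ 2) - 2 * |a|) / (2 * a) := by
    rw [hystar, sq_abs]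
    field_simp
    ring
  have abs_a_pos : 0 < |a| := abs_pos.mpr ha
  rw [sign_eq, rewrite_diff, abs_div, abs_mul, abs_two, ← sq_abs a]
  calc |Real.sqrt (1 + 4 * |a| ^ 2) - 2 * (|a|)| / (2 * |a|)
      ≤ 1 / (4 * |a|) / (2 * |a|) := by
        gcongr
        exact abs_sqrt_one_add_four_mul_sq_sub_le abs_a_pos
    _ = 1 / (8 * |a| ^ 2) := by
        field_simp
        norm_num
end

section
/- There exists a function g : ℝ × ℝ → ℝ, real-analytic in its second argument for each fixed first argument, such that for all real t and λ: sin((1 + λ/2)·π·t) = ((1+λ)/2)·sin(3πt/2) + ((1-λ)/2)·sin(πt/2) + (λ²-1)·g(t,λ). -/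
theorem AnalyticAt.dslope {𝕜 E : Type*} [NontriviallyNormedField 𝕜] [NormedAddCommGroup E]
    [NormedSpace 𝕜 E] {f : 𝕜 → E} {x : 𝕜} (hf : AnalyticAt 𝕜 f x) (a : 𝕜) :
    AnalyticAt 𝕜 (dslope f a) x := by
  rcases eq_or_ne x a with rfl | hne
  · obtain ⟨p, hp⟩ := hf
    exact ⟨_, hp.has_fpower_series_dslope_fslope⟩
  · have hslope : AnalyticAt 𝕜 (fun y => (y - a)⁻¹ • (f y - f a)) x :=
      ((analyticAt_id.sub analyticAt_const).inv (sub_ne_zero.mpr hne)).smul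
        (hf.sub analyticAt_const)
    exact hslope.congr (dslope_eventuallyEq_slope_of_ne f hne).symm

/-- A function vanishing at `1` and `-1` is `x ^ 2 - 1` times its iterated divided slope. -/
theorem sq_sub_one_mul_dslope_dslope {𝕜 : Type*} [NontriviallyNormedField 𝕜] [CharZero 𝕜]
    {f : 𝕜 → 𝕜} (h₁ : f 1 = 0) (h₂ : f (-1) = 0) (x : 𝕜) :
    (x ^ 2 - 1) * dslope (dslope f 1) (-1) x = f x := by
  have hx := sub_smul_dslope f 1 x
  have hneg := sub_smul_dslope f 1 (-1)
  have hxx := sub_smul_dslope (dslope f 1) (-1) x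
  simp only [smul_eq_mul, h₁, h₂, sub_zero] at hx hneg hxx
  have hzero : dslope f 1 (-1) = 0 :=
    (mul_eq_zero.mp hneg).resolve_left (by norm_num)
  rw [hzero, sub_zero] at hxx
  rw [← hx, ← hxx]
  ring

/-- Decomposition of the switched-frequency forcing: there is a function `g(t,λ)`,
real-analytic in `λ` for each fixed `t`, with
`sin((1+λ/2)πt) = ((1+λ)/2) sin(3πt/2) + ((1-λ)/2) sin(πt/2) + (λ²-1) g(t,λ)`. -/
theorem switched_forcing_decomposition :
    ∃ g : ℝ × ℝ → ℝ,
      (∀ t : ℝ, AnalyticOn ℝ (fun l : ℝ => g (t, l)) Set.univ) ∧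
      ∀ t l : ℝ,
        Real.sin ((1 + l / 2) * Real.pi * t) =
          (1 + l) / 2 * Real.sin (3 * Real.pi * t / 2) +
          (1 - l) / 2 * Real.sin (Real.pi * t / 2) +
          (l ^ 2 - 1) * g (t, l) := by
  let f : ℝ → ℝ → ℝ := fun t l => Real.sin ((1 + l / 2) * Real.pi * t) -
    ((1 + l) / 2 * Real.sin (3 * Real.pi * t / 2) + (1 - l) / 2 * Real.sin (Real.pi * t / 2))
  refine ⟨fun p => dslope (dslope (f p.1) 1) (-1) p.2, fun t l _ => ?_, fun t l => ?_⟩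
  · have hf : AnalyticAt ℝ (f t) l := by
      dsimp only [f]
      fun_prop
    exact ((hf.dslope 1).dslope (-1)).analyticWithinAt
  · have h₁ : f t 1 = 0 := by
      have harg : (1 + 1 / 2) * Real.pi * t = 3 * Real.pi * t / 2 := by ring
      simp only [f, harg]
      ring
    have h₂ : f t (-1) = 0 := by
      have harg : (1 + -1 / 2) * Real.pi * t = Real.pi * t / 2 := by ring
      simp only [f, harg]
      ring
    rw [sq_sub_one_mul_dslope_dslope h₁ h₂ l]
    simp only [f]
    ring
end
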